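/- If in addition m₀K₀ > 0, then the set of positive zeros { s > 0 : F(s) = 0 } of the first characteristic function is bounded and has no accumulation point in (0, ∞); in particular every positive zero of F is isolated, and the positive zeros may accumulate only at the origin. -/

import Mathlib

open Filter Topology

theorem abs_one_sub_exp_div_one_add_exp_le_one (x : ℝ) :
    |(1 - Real.exp x) / (1 + Real.exp x)| ≤ 1 := by
  have h := Real.exp_pos x
  rw [abs_div, abs_of_pos (by linarith : 0 < 1 + Real.exp x), div_le_one (by linarith), abs_le]
  constructor <;> linarith

theorem norm_exp_neg_mul_lt {a b δ : ℝ} {z : ℂ} (hδ : 0 < δ) (ha : 0 < a) (hab : a ≤ b)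
    (hz : δ < z.re) : ‖Complex.exp (-(b : ℂ) * z)‖ < Real.exp (-a * δ) := by
  rw [Complex.norm_exp]
  have hre : (-(b : ℂ) * z).re = -(b * z.re) := by simp
  rw [hre, Real.exp_lt_exp]
  nlinarith

theorem one_sub_exp_le_norm_one_add_exp {a b δ : ℝ} {z : ℂ} (hδ : 0 < δ) (ha : 0 < a)
    (hab : a ≤ b) (hz : δ < z.re) :
    1 - Real.exp (-a * δ) ≤ ‖1 + Complex.exp (-(b : ℂ) * z)‖ := by
  have h := norm_exp_neg_mul_lt hδ ha hab hz
  have h' := norm_sub_le_norm_add (1 : ℂ) (Complex.exp (-(b : ℂ) * z))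
  rw [norm_one] at h'
  linarith

theorem exp_neg_mul_lt_one {a δ : ℝ} (hδ : 0 < δ) (ha : 0 < a) : Real.exp (-a * δ) < 1 := by
  rw [Real.exp_lt_one_iff]
  nlinarith

/-- A series `∑ cⱼ tanh (λⱼ z / 2)` with summable coefficients and exponents bounded below by a
positive number is holomorphic on every half-plane `δ < re z` with `0 < δ`. -/
theorem differentiableOn_tsum_one_sub_exp_div_one_add_exp {c lam : ℕ → ℝ} {a δ : ℝ}
    (hc : Summable fun j => |c j|) (ha : 0 < a) (hlam : ∀ j, a ≤ lam j) (hδ : 0 < δ) :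
    DifferentiableOn ℂ (fun z : ℂ => ∑' j, (c j : ℂ) *
      ((1 - Complex.exp (-(lam j : ℂ) * z)) / (1 + Complex.exp (-(lam j : ℂ) * z))))
      {z | δ < z.re} := by
  have hlt := exp_neg_mul_lt_one hδ ha
  refine Complex.differentiableOn_tsum_of_summable_norm
    (hc.mul_right (2 / (1 - Real.exp (-a * δ)))) (fun j => ?_)
    (isOpen_lt continuous_const Complex.continuous_re) (fun j z hz => ?_)
  · have hne : ∀ z ∈ {z : ℂ | δ < z.re}, 1 + Complex.exp (-(lam j : ℂ) * z) ≠ 0 := by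
      intro z hz
      rw [← norm_pos_iff]
      linarith [one_sub_exp_le_norm_one_add_exp hδ ha (hlam j) hz]
    exact (DifferentiableOn.div (by fun_prop) (by fun_prop) hne).const_mul _
  · rw [norm_mul, norm_div, Complex.norm_real, Real.norm_eq_abs]
    gcongr
    · refine (norm_sub_le _ _).trans ?_
      rw [norm_one]
      linarith [norm_exp_neg_mul_lt hδ ha (hlam j) hz]
    · exact one_sub_exp_le_norm_one_add_exp hδ ha (hlam j) hz

/-- A function on `ℝ` whose zeros accumulate at a point where it extends to a holomorphic function
on a preconnected open set vanishes on the real points of that set. -/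
theorem eq_zero_of_accPt_zeros {f : ℝ → ℝ} {g : ℂ → ℂ} {U : Set ℂ} {S : Set ℝ} {x : ℝ}
    (hU : IsOpen U) (hUc : IsPreconnected U) (hg : DifferentiableOn ℂ g U)
    (hfg : ∀ s : ℝ, g s = f s) (hx : (x : ℂ) ∈ U) (hS : ∀ s ∈ S, f s = 0)
    (hacc : AccPt x (𝓟 S)) {y : ℝ} (hy : (y : ℂ) ∈ U) : f y = 0 := by
  have hfreq : ∃ᶠ z in 𝓝[≠] (x : ℂ), g z = 0 := by
    have ht : Tendsto (fun s : ℝ => (s : ℂ)) (𝓝[≠] x) (𝓝[≠] (x : ℂ)) :=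
      Complex.continuous_ofReal.continuousAt.continuousWithinAt.tendsto_nhdsWithin
        fun s hs => by simpa using hs
    refine ht.frequently ((accPt_iff_frequently_nhdsNE.1 hacc).mono fun s hs => ?_)
    rw [hfg, hS s hs, Complex.ofReal_zero]
  have h := (hg.analyticOnNhd hU).eqOn_zero_of_preconnected_of_frequently_eq_zero hUc hx hfreq hy
  exact Complex.ofReal_eq_zero.1 ((hfg y).symm.trans h)

/-- If `m₀K₀ > 0`, the set of positive zeros of the first characteristic
function is bounded and has no accumulation point in `(0, ∞)`: every positive
zero of `F` is isolated and the positive zeros may accumulate only at the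
origin. -/
theorem first_characteristic_zeros_isolated
    (m₀K₀ : ℝ) (lam m K : ℕ → ℝ)
    (hpos : ∀ j, 0 < lam j) (hmono : StrictMono lam)
    (hinf : Tendsto lam atTop atTop)
    (hsum : Summable fun j => |m j * K j| / lam j)
    (hm₀K₀ : 0 < m₀K₀)
    (F : ℝ → ℝ)
    (hF : ∀ s, F s = m₀K₀ * s + 2 * ∑' j, (m j * K j / lam j) *
      ((1 - Real.exp (-lam j * s)) / (1 + Real.exp (-lam j * s)))) :
    Bornology.IsBounded {s : ℝ | 0 < s ∧ F s = 0} ∧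
      ∀ x ∈ Set.Ioi (0 : ℝ), ¬ AccPt x (𝓟 {s : ℝ | 0 < s ∧ F s = 0}) := by
  set c : ℕ → ℝ := fun j => m j * K j / lam j with hcdef
  have hc : Summable fun j => |c j| := by
    simpa only [hcdef, abs_div, abs_of_pos (hpos _)] using hsum
  have hbound : ∀ s, |∑' j, c j *
      ((1 - Real.exp (-lam j * s)) / (1 + Real.exp (-lam j * s)))| ≤ ∑' j, |c j| := fun s =>
    tsum_of_norm_bounded (f := fun j => c j *
      ((1 - Real.exp (-lam j * s)) / (1 + Real.exp (-lam j * s)))) hc.hasSum fun j => by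
      rw [norm_mul, Real.norm_eq_abs, Real.norm_eq_abs]
      exact mul_le_of_le_one_right (abs_nonneg _) (abs_one_sub_exp_div_one_add_exp_le_one _)
  have hzero : ∀ s, F s = 0 → s ≤ 2 * (∑' j, |c j|) / m₀K₀ := by
    intro s hs
    rw [hF] at hs
    rw [le_div_iff₀ hm₀K₀]
    linarith [(abs_le.1 (hbound s)).1]
  refine ⟨(Metric.isBounded_Icc 0 (2 * (∑' j, |c j|) / m₀K₀)).subset
    fun s hs => ⟨hs.1.le, hzero s hs.2⟩, fun x hx hacc => ?_⟩
  have hx : 0 < x := hx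
  have hdiff := differentiableOn_tsum_one_sub_exp_div_one_add_exp hc (hpos 0)
    (fun j => hmono.monotone j.zero_le) (half_pos hx)
  have hvanish : ∀ y : ℝ, x / 2 < y → F y = 0 := fun y hy =>
    eq_zero_of_accPt_zeros (U := {z : ℂ | x / 2 < z.re})
      (isOpen_lt continuous_const Complex.continuous_re)
      (convex_halfSpace_re_gt _).isPreconnected
      (((differentiable_id.const_mul (m₀K₀ : ℂ)).differentiableOn).add (hdiff.const_mul 2))
      (fun s => by simp [hF, hcdef, Complex.ofReal_tsum])
      (by simpa using hx) (fun s hs => hs.2) hacc (by simpa using hy)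
  obtain ⟨y, hy⟩ := exists_gt (max (x / 2) (2 * (∑' j, |c j|) / m₀K₀))
  rw [max_lt_iff] at hy
  exact (hzero y (hvanish y hy.1)).not_gt hy.2
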